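/- For every d ≥ 1 and every 0 ≤ i ≤ d, the optimal oneshot pebbling cost of the tradeoff DAG T(d,m) with d + 2 + i red pebbles equals 2(d − i)·m up to an additive error bounded by a function of d alone (independent of m); in particular, for each fixed d and i, opt(d + 2 + i) = 2(d − i)·m + O(1) as m → ∞, so the optimum cost drops by exactly 2m (up to bounded error) for each additional red pebble between R = d + 2 and R = 2d + 2. -/

import Mathlib

namespace RBPebble

open scoped Classical

/-- A pebble is either red (fast memory) or blue (slow memory). -/
inductive Peb : Type
  | red
  | blue
  deriving DecidableEq

/-- The four kinds of moves of a red-blue pebbling. -/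
inductive Move (V : Type) : Type
  | toRed (v : V)    -- (1) replace a blue pebble by a red pebble
  | toBlue (v : V)   -- (2) replace a red pebble by a blue pebble
  | compute (v : V)  -- (3) place a red pebble on a node whose in-neighbors are all red
  | delete (v : V)   -- (4) delete a pebble
  deriving DecidableEq

variable {V : Type}

/-- A configuration assigns to each node no pebble, a red pebble, or a blue pebble. -/
def Config (V : Type) : Type := V → Option Peb

/-- The initial configuration: no pebbles anywhere. -/
def initConfig : Config V := fun _ => none

/-- The effect of a move on a configuration. -/
def applyMove [DecidableEq V] (c : Config V) : Move V → Config V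
  | .toRed v => Function.update c v (some Peb.red)
  | .toBlue v => Function.update c v (some Peb.blue)
  | .compute v => Function.update c v (some Peb.red)
  | .delete v => Function.update c v none

/-- The number of red pebbles in a configuration. -/
noncomputable def redCount [Fintype V] (c : Config V) : ℕ :=
  (Finset.univ.filter fun v => c v = some Peb.red).card

/-- Legality of a move in a given configuration (base model). -/
def legalMove (edge : V → V → Prop) (c : Config V) : Move V → Prop
  | .toRed v => c v = some Peb.blue
  | .toBlue v => c v = some Peb.red
  | .compute v => ∀ u, edge u v → c u = some Peb.red
  | .delete v => c v ≠ none

/-- A sequence of moves is valid from a configuration: every move is legal and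
at every point at most `R` red pebbles are on the graph. -/
def ValidFrom [Fintype V] [DecidableEq V] (edge : V → V → Prop) (R : ℕ) :
    Config V → List (Move V) → Prop
  | _, [] => True
  | c, m :: ms =>
      legalMove edge c m ∧ redCount (applyMove c m) ≤ R ∧
        ValidFrom edge R (applyMove c m) ms

/-- Running a list of moves from a configuration. -/
def runMoves [DecidableEq V] (c : Config V) : List (Move V) → Config V
  | [] => c
  | m :: ms => runMoves (applyMove c m) ms

/-- A sink: a node with no outgoing edge. -/
def IsSink (edge : V → V → Prop) (v : V) : Prop := ∀ u, ¬ edge v u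

/-- A source: a node with no incoming edge. -/
def IsSource (edge : V → V → Prop) (v : V) : Prop := ∀ u, ¬ edge u v

/-- A valid pebbling of the DAG with `R` red pebbles: starts from the empty
configuration, is valid throughout, and in the final configuration every sink
carries a pebble (of either color). -/
def IsPebbling [Fintype V] [DecidableEq V] (edge : V → V → Prop) (R : ℕ)
    (moves : List (Move V)) : Prop :=
  ValidFrom edge R initConfig moves ∧
    ∀ v, IsSink edge v → runMoves initConfig moves v ≠ none

def isTransfer : Move V → Bool
  | .toRed _ => true
  | .toBlue _ => true
  | _ => false

def isCompute : Move V → Bool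
  | .compute _ => true
  | _ => false

def isDelete : Move V → Bool
  | .delete _ => true
  | _ => false

/-- The cost of a pebbling: the number of moves of types (1) and (2). -/
def cost (moves : List (Move V)) : ℕ := (moves.filter isTransfer).length

/-- The number of compute moves (type (3)). -/
def computeCount (moves : List (Move V)) : ℕ := (moves.filter isCompute).length

/-- The number of delete moves (type (4)). -/
def deleteCount (moves : List (Move V)) : ℕ := (moves.filter isDelete).length

/-- The cost in the compcost model: transfers plus `ε` times the computes. -/
noncomputable def ccCost (ε : ℝ) (moves : List (Move V)) : ℝ :=
  (cost moves : ℝ) + ε * (computeCount moves : ℝ)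

/-- The oneshot restriction: each node is computed at most once. -/
def Oneshot [DecidableEq V] (moves : List (Move V)) : Prop :=
  ∀ v : V, moves.count (Move.compute v) ≤ 1

/-- The nodel restriction: no delete moves are used. -/
def NoDel (moves : List (Move V)) : Prop := ∀ m ∈ moves, isDelete m = false

/-- The indegree of a node. -/
noncomputable def indeg [Fintype V] (edge : V → V → Prop) (v : V) : ℕ :=
  (Finset.univ.filter fun u => edge u v).card

/-- The edge relation is acyclic (the graph is a DAG). -/
def Acyclic (edge : V → V → Prop) : Prop :=
  ∀ v, ¬ Relation.TransGen edge v v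

/-- The optimal cost of a valid pebbling with `R` red pebbles in the oneshot model. -/
noncomputable def optCost [Fintype V] [DecidableEq V] (edge : V → V → Prop) (R : ℕ) : ℕ :=
  sInf {c | ∃ moves : List (Move V),
    IsPebbling edge R moves ∧ Oneshot moves ∧ cost moves = c}

/-- The node type of the tradeoff DAG `T(d,m)`: the control group `A` (left
summand), the control group `B` (right summand), and the chain nodes
`c_1, …, c_m` (here `Fin m`, with index `j` representing `c_{j+1}`). -/
abbrev TNode (d m : ℕ) : Type := (Fin d ⊕ Fin d) ⊕ Fin m

/-- The edge relation of the tradeoff DAG `T(d,m)`: the in-neighbor set of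
`c_1` is exactly `A`, and for `2 ≤ p ≤ m` the in-neighbor set of `c_p` is
`{c_{p−1}} ∪ A` if `p` is odd and `{c_{p−1}} ∪ B` if `p` is even
(with `j : Fin m` representing `c_{j+1}`). -/
def tEdge (d m : ℕ) : TNode d m → TNode d m → Prop := fun u v =>
  match u, v with
  | Sum.inl (Sum.inl _), Sum.inr j => j.val % 2 = 0
  | Sum.inl (Sum.inr _), Sum.inr j => j.val % 2 = 1
  | Sum.inr j, Sum.inr j' => j.val + 1 = j'.val
  | _, _ => False

section General

/-- The configuration `c` with the pebble at `v` replaced by `x`. -/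
def setAt [DecidableEq V] (c : Config V) (v : V) (x : Option Peb) : Config V :=
  Function.update c v x

@[simp]
theorem setAt_self [DecidableEq V] (c : Config V) (v : V) (x : Option Peb) :
    setAt c v x v = x :=
  Function.update_self (β := fun _ => Option Peb) v x c

@[simp]
theorem setAt_of_ne [DecidableEq V] (c : Config V) {u v : V} (h : u ≠ v) (x : Option Peb) :
    setAt c v x u = c u :=
  Function.update_of_ne (β := fun _ => Option Peb) h x c

theorem applyMove_toRed [DecidableEq V] (c : Config V) (v : V) :
    applyMove c (.toRed v) = setAt c v (some Peb.red) := rfl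

theorem applyMove_toBlue [DecidableEq V] (c : Config V) (v : V) :
    applyMove c (.toBlue v) = setAt c v (some Peb.blue) := rfl

theorem applyMove_compute [DecidableEq V] (c : Config V) (v : V) :
    applyMove c (.compute v) = setAt c v (some Peb.red) := rfl

theorem applyMove_delete [DecidableEq V] (c : Config V) (v : V) :
    applyMove c (.delete v) = setAt c v none := rfl

theorem redCount_le_card [Fintype V] {c : Config V} (U : Finset V)
    (h : ∀ v, c v = some Peb.red → v ∈ U) : redCount c ≤ U.card :=
  Finset.card_le_card fun v hv => h v (by simpa using hv)

theorem card_le_redCount [Fintype V] {c : Config V} (U : Finset V)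
    (h : ∀ v ∈ U, c v = some Peb.red) : U.card ≤ redCount c :=
  Finset.card_le_card fun v hv => by simpa using h v hv

variable [DecidableEq V] {edge : V → V → Prop} {R : ℕ}

theorem runMoves_append (c : Config V) (l₁ l₂ : List (Move V)) :
    runMoves c (l₁ ++ l₂) = runMoves (runMoves c l₁) l₂ := by
  induction l₁ generalizing c with
  | nil => rfl
  | cons x l ih => exact ih _

theorem validFrom_append [Fintype V] (c : Config V) (l₁ l₂ : List (Move V)) :
    ValidFrom edge R c (l₁ ++ l₂) ↔
      ValidFrom edge R c l₁ ∧ ValidFrom edge R (runMoves c l₁) l₂ := by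
  induction l₁ generalizing c with
  | nil => simp [ValidFrom, runMoves]
  | cons x l ih => simp [ValidFrom, runMoves, ih, and_assoc]

/-- Applying moves of the same kind `f`, each setting its node to `col`, to the nodes of a
duplicate-free list, while all red pebbles stay inside a set `U` of at most `R` nodes. -/
theorem bulk_moves [Fintype V] (f : V → Move V) (col : Option Peb)
    (hf : ∀ c v, applyMove c (f v) = setAt c v col) (U : Finset V) (hU : U.card ≤ R)
    (L : List V) (hL : L.Nodup) (c : Config V)
    (hc : ∀ v, c v = some Peb.red → v ∈ U) (hcol : col = some Peb.red → ∀ v ∈ L, v ∈ U)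
    (hlegal : ∀ v ∈ L, ∀ c' : Config V, (∀ u, u ∉ L → c' u = c u) → c' v = c v →
      legalMove edge c' (f v)) :
    ValidFrom edge R c (L.map f) ∧
      runMoves c (L.map f) = fun v => if v ∈ L then col else c v := by
  induction L generalizing c with
  | nil => simp [ValidFrom, runMoves]
  | cons a L ih =>
    have hnd := List.nodup_cons.1 hL
    have hred : ∀ v, setAt c a col v = some Peb.red → v ∈ U := by
      intro v hv
      by_cases hva : v = a
      · subst hva
        exact hcol (by simpa using hv) v (by simp)
      · exact hc v (by simpa [hva] using hv)
    obtain ⟨h₁, h₂⟩ := ih hnd.2 (setAt c a col) hred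
      (fun h v hv => hcol h v (by simp [hv])) (by
        intro v hv c' h₁ h₂
        have hva : v ≠ a := fun h => hnd.1 (h ▸ hv)
        refine hlegal v (by simp [hv]) c' (fun u hu => ?_) (by simpa [hva] using h₂)
        simp only [List.mem_cons, not_or] at hu
        simpa [hu.1] using h₁ u hu.2)
    refine ⟨⟨hlegal a (by simp) c (fun _ _ => rfl) rfl, ?_, ?_⟩, ?_⟩
    · rw [hf]
      exact (redCount_le_card U hred).trans hU
    · rw [hf]
      exact h₁
    · simp only [List.map_cons, runMoves, hf, h₂]
      funext v
      by_cases hva : v = a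
      · subst hva
        simp [hnd.1]
      · simp [hva]

/-- Moves of type (1). -/
def isLoad : Move V → Bool
  | .toRed _ => true
  | _ => false

/-- The number of nodes carrying a pebble of color `q`. -/
def pebCount [Fintype V] (g : V → Option Peb) (q : Peb) : ℕ :=
  ∑ v, if g v = some q then 1 else 0

theorem pebCount_update [Fintype V] (g : V → Option Peb) (v : V) (x : Option Peb) (q : Peb) :
    pebCount (Function.update g v x) q + (if g v = some q then 1 else 0) =
      pebCount g q + (if x = some q then 1 else 0) := by
  have key : ∀ g : V → Option Peb, pebCount g q = (if g v = some q then 1 else 0) +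
      ∑ u ∈ Finset.univ.erase v, if g u = some q then 1 else 0 := fun g =>
    (Finset.add_sum_erase _ (fun u => if g u = some q then 1 else 0) (Finset.mem_univ v)).symm
  have h₃ : (∑ u ∈ Finset.univ.erase v, if Function.update g v x u = some q then 1 else 0) =
      ∑ u ∈ Finset.univ.erase v, if g u = some q then 1 else 0 :=
    Finset.sum_congr rfl fun u hu => by
      rw [Function.update_of_ne (Finset.ne_of_mem_erase hu)]
  rw [key, key g, h₃, Function.update_self]
  omega

theorem pebCount_setAt [Fintype V] (c : Config V) (v : V) (x : Option Peb) (q : Peb) :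
    pebCount (setAt c v x) q + (if c v = some q then 1 else 0) =
      pebCount c q + (if x = some q then 1 else 0) := by
  convert pebCount_update c v x q
  rfl

/-- Every load consumes a blue pebble, and blue pebbles only come from stores. -/
theorem two_mul_loads_le [Fintype V] (c : Config V) (l : List (Move V))
    (h : ValidFrom edge R c l) :
    2 * l.countP isLoad + pebCount (runMoves c l) Peb.blue ≤ cost l + pebCount c Peb.blue := by
  induction l generalizing c with
  | nil => simp [cost, runMoves]
  | cons x l ih =>
    obtain ⟨hx, -, hl⟩ := h
    have := ih _ hl
    rw [List.countP_cons, cost, List.filter_cons]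
    unfold cost at this
    cases x with
    | toRed v =>
      have hb := pebCount_setAt c v (some Peb.red) Peb.blue
      simp only [runMoves, applyMove_toRed] at this ⊢
      simp only [show c v = some Peb.blue from hx] at hb
      simp [isLoad, isTransfer] at hb ⊢
      omega
    | toBlue v =>
      have hb := pebCount_setAt c v (some Peb.blue) Peb.blue
      simp only [runMoves, applyMove_toBlue] at this ⊢
      simp [isLoad, isTransfer] at hb ⊢
      omega
    | compute v =>
      have hb := pebCount_setAt c v (some Peb.red) Peb.blue
      simp only [runMoves, applyMove_compute] at this ⊢
      simp [isLoad, isTransfer] at hb ⊢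
      omega
    | delete v =>
      have hb := pebCount_setAt c v none Peb.blue
      simp only [runMoves, applyMove_delete] at this ⊢
      simp [isLoad, isTransfer] at hb ⊢
      omega

end General

section Tradeoff

variable {d m : ℕ}

/-- The `k`-th node of the control group feeding the chain nodes of the parity of `n`. -/
def ctrl (d m n : ℕ) (k : Fin d) : TNode d m :=
  if n % 2 = 0 then Sum.inl (Sum.inl k) else Sum.inl (Sum.inr k)

theorem ctrl_injective (n : ℕ) : Function.Injective (ctrl d m n) := by
  intro a b h
  unfold ctrl at h
  split_ifs at h <;> simpa using h

theorem tEdge_ctrl (k : Fin d) (j : Fin m) : tEdge d m (ctrl d m j k) (Sum.inr j) := by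
  unfold ctrl
  split_ifs with h
  · exact h
  · simp only [tEdge]
    omega

/-- The number of red pebbles in the control group feeding chain node `n`. -/
noncomputable def redCtrl (c : Config (TNode d m)) (n : ℕ) : ℕ :=
  (Finset.univ.filter fun k => c (ctrl d m n k) = some Peb.red).card

theorem redCtrl_le (c : Config (TNode d m)) (n : ℕ) : redCtrl c n ≤ d :=
  (Finset.card_le_univ _).trans (by simp)

/-- A move on one node changes the number of red pebbles of a group by at most one. -/
theorem redCtrl_update_le (c : Config (TNode d m)) (n : ℕ) (v : TNode d m) (x : Option Peb) :
    redCtrl (setAt c v x) n ≤ redCtrl c n + 1 := by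
  unfold redCtrl
  by_cases hv : ∃ k, ctrl d m n k = v
  · obtain ⟨k, rfl⟩ := hv
    refine (Finset.card_le_card (t := insert k
      (Finset.univ.filter fun k => c (ctrl d m n k) = some Peb.red)) ?_).trans
      (Finset.card_insert_le _ _)
    intro u hu
    by_cases huk : u = k
    · simp [huk]
    · have : ctrl d m n u ≠ ctrl d m n k := fun h => huk (ctrl_injective n h)
      simpa [this, huk] using hu
  · push Not at hv
    simp [setAt_of_ne _ (hv _)]

theorem redCtrl_update_le_of_ne_red (c : Config (TNode d m)) (n : ℕ) (v : TNode d m)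
    (x : Option Peb) (hx : x ≠ some Peb.red) :
    redCtrl (setAt c v x) n ≤ redCtrl c n := by
  refine Finset.card_le_card fun k hk => ?_
  by_cases hv : ctrl d m n k = v
  · subst hv
    simp [hx] at hk
  · simpa [hv] using hk

/-- If the group feeding `n` is entirely red and two chain nodes are red, the other group has few
red pebbles. -/
theorem redCtrl_add_le_redCount (c : Config (TNode d m)) (n : ℕ) (a b : Fin m) (hab : a ≠ b)
    (ha : c (Sum.inr a) = some Peb.red) (hb : c (Sum.inr b) = some Peb.red)
    (hc : ∀ k, c (ctrl d m n k) = some Peb.red) :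
    d + redCtrl c (n + 1) + 2 ≤ redCount c := by
  have hpair : ({a, b} : Finset (Fin m)).card = 2 := Finset.card_pair hab
  rcases Nat.mod_two_eq_zero_or_one n with h | h
  · have h' : (n + 1) % 2 = 1 := by omega
    have := card_le_redCount (c := c) (((Finset.univ : Finset (Fin d)).disjSum
      (Finset.univ.filter fun k => c (ctrl d m (n + 1) k) = some Peb.red)).disjSum {a, b}) (by
        simp only [ctrl, h, h'] at hc ⊢
        rintro ((v | v) | v) hv <;> simp_all
        rcases hv with rfl | rfl <;> assumption)
    simp only [Finset.card_disjSum, hpair, Finset.card_univ, Fintype.card_fin] at this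
    exact this
  · have h' : (n + 1) % 2 = 0 := by omega
    have := card_le_redCount (c := c) ((Finset.disjSum
      (Finset.univ.filter fun k => c (ctrl d m (n + 1) k) = some Peb.red)
      (Finset.univ : Finset (Fin d))).disjSum {a, b}) (by
        simp only [ctrl, h, h'] at hc ⊢
        rintro ((v | v) | v) hv <;> simp_all
        rcases hv with rfl | rfl <;> assumption)
    simp only [Finset.card_disjSum, hpair, Finset.card_univ, Fintype.card_fin] at this
    unfold redCtrl
    omega

/-- The number of computations of control nodes. -/
def ctrlComputes (l : List (Move (TNode d m))) : ℕ :=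
  ∑ v : Fin d ⊕ Fin d, l.count (Move.compute (Sum.inl v))

theorem ctrlComputes_append (l₁ l₂ : List (Move (TNode d m))) :
    ctrlComputes (l₁ ++ l₂) = ctrlComputes l₁ + ctrlComputes l₂ := by
  simp [ctrlComputes, List.count_append, Finset.sum_add_distrib]

theorem ctrlComputes_singleton (v : Fin d ⊕ Fin d) :
    ctrlComputes (m := m) [Move.compute (Sum.inl v)] = 1 := by
  simp [ctrlComputes, List.count_singleton]

theorem ctrlComputes_le (l : List (Move (TNode d m))) (h : Oneshot l) :
    ctrlComputes l ≤ 2 * d := by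
  refine (Finset.sum_le_sum fun v _ => h (Sum.inl v)).trans ?_
  simp
  omega

/-- After `n` chain nodes have been computed, enough control nodes have been loaded or computed to
turn the alternating groups red `n` times, up to an additive `2 * d`. -/
theorem exists_computed_chain (i : ℕ) (l : List (Move (TNode d m)))
    (hl : ValidFrom (tEdge d m) (d + 2 + i) initConfig l) (ho : Oneshot l) :
    ∃ n : ℕ, (∀ k : Fin m, runMoves initConfig l (Sum.inr k) ≠ none → k.val < n) ∧
      (∀ k : Fin m, k.val < n → Move.compute (Sum.inr k) ∈ l) ∧
      (d - i) * n + (redCtrl (runMoves initConfig l) n - i) ≤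
        l.countP isLoad + ctrlComputes l + 2 * d := by
  induction l using List.reverseRecOn with
  | nil =>
    refine ⟨0, by simp [runMoves, initConfig], by simp, ?_⟩
    have := redCtrl_le (runMoves initConfig ([] : List (Move (TNode d m)))) 0
    omega
  | append_singleton l x ih =>
    rw [validFrom_append] at hl
    obtain ⟨hl, hx, hR, -⟩ := hl
    obtain ⟨n, h₁, h₂, h₃⟩ := ih hl fun v => (by
      have := ho v
      rw [List.count_append] at this
      omega)
    have hx₁ : ∀ v, x = Move.compute v → Move.compute v ∉ l := by
      rintro v rfl hv
      have := ho v
      have h0 := List.count_pos_iff.2 hv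
      rw [List.count_append] at this
      simp at this
      omega
    rw [runMoves_append, List.countP_append, ctrlComputes_append]
    simp only [runMoves]
    generalize runMoves initConfig l = c at *
    cases x with
    | toRed v =>
      refine ⟨n, fun k hk => h₁ k ?_, fun k hk => by simp [h₂ k hk], ?_⟩
      · intro h
        have hv : Sum.inr k ≠ v := by
          rintro rfl
          simp [legalMove, h] at hx
        simp [applyMove_toRed, hv, h] at hk
      · have := redCtrl_update_le c n v (some Peb.red)
        simp only [applyMove_toRed, List.countP_singleton, isLoad, if_true]
        omega
    | toBlue v =>
      refine ⟨n, fun k hk => h₁ k ?_, fun k hk => by simp [h₂ k hk], ?_⟩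
      · intro h
        have hv : Sum.inr k ≠ v := by
          rintro rfl
          simp [legalMove, h] at hx
        simp [applyMove_toBlue, hv, h] at hk
      · have := redCtrl_update_le_of_ne_red c n v (some Peb.blue) (by simp)
        simp only [applyMove_toBlue]
        omega
    | delete v =>
      refine ⟨n, fun k hk => h₁ k ?_, fun k hk => by simp [h₂ k hk], ?_⟩
      · intro h
        have hv : Sum.inr k ≠ v := by
          rintro rfl
          simp [legalMove, h] at hx
        simp [applyMove_delete, hv, h] at hk
      · have := redCtrl_update_le_of_ne_red c n v none (by simp)
        simp only [applyMove_delete]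
        omega
    | compute v =>
      rcases v with v | j
      · refine ⟨n, fun k hk => h₁ k ?_, fun k hk => by simp [h₂ k hk], ?_⟩
        · intro h
          simp [applyMove_compute, h] at hk
        · have := redCtrl_update_le c n (Sum.inl v) (some Peb.red)
          rw [ctrlComputes_singleton]
          simp only [applyMove_compute]
          omega
      · have hnj : n ≤ j.val := by
          by_contra h
          exact hx₁ _ rfl (h₂ j (by omega))
        have hpred : ∀ k : Fin m, k.val + 1 = j.val → c (Sum.inr k) = some Peb.red :=
          fun k hk => hx (Sum.inr k) hk
        have hj : j.val = n := by
          by_contra h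
          have := h₁ ⟨j.val - 1, by omega⟩ (by
            rw [hpred _ (by simp only; omega)]
            simp)
          simp only at this
          omega
        have hall : ∀ k, c (ctrl d m n k) = some Peb.red := fun k => hx _ (hj ▸ tEdge_ctrl k j)
        refine ⟨n + 1, fun k hk => ?_, fun k hk => ?_, ?_⟩
        · by_cases hkj : k = j
          · omega
          · have := h₁ k (by simpa [applyMove_compute, hkj] using hk)
            omega
        · by_cases hkj : k = j
          · simp [hkj]
          · have : k.val ≠ j.val := fun h => hkj (Fin.ext h)
            simp [h₂ k (by omega)]
        · have hfull : redCtrl c n = d := by simp [redCtrl, hall]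
          rw [hfull] at h₃
          rw [mul_add, mul_one]
          rcases Nat.eq_zero_or_pos n with hn | hn
          · have := redCtrl_le (applyMove c (Move.compute (Sum.inr j))) (n + 1)
            subst hn
            omega
          · have hne : (⟨n - 1, by omega⟩ : Fin m) ≠ j := by
              intro h
              have := congrArg Fin.val h
              simp only at this
              omega
            have := redCtrl_add_le_redCount (applyMove c (Move.compute (Sum.inr j))) n
              ⟨n - 1, by omega⟩ j hne
              (by simpa [applyMove_compute, hne] using hpred _ (by simp only; omega))
              (by simp [applyMove_compute])
              (fun k => by
                have : ctrl d m n k ≠ Sum.inr j := by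
                  unfold ctrl
                  split_ifs <;> simp
                simp [applyMove_compute, this, hall])
            omega

theorem isSink_last (hm : 1 ≤ m) : IsSink (tEdge d m) (Sum.inr ⟨m - 1, by omega⟩) := by
  rintro ((u | u) | u) h <;> simp only [tEdge] at h
  omega

theorem le_cost (i : ℕ) (hm : 1 ≤ m) (l : List (Move (TNode d m)))
    (hl : IsPebbling (tEdge d m) (d + 2 + i) l) (ho : Oneshot l) :
    2 * ((d - i) * m) ≤ cost l + 8 * d := by
  obtain ⟨n, h₁, -, h₃⟩ := exists_computed_chain i l hl.1 ho
  have hn := h₁ _ (hl.2 _ (isSink_last hm))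
  simp only at hn
  have hmn : (d - i) * m ≤ (d - i) * n := Nat.mul_le_mul_left _ (by omega)
  have hK := ctrlComputes_le l ho
  have hL := two_mul_loads_le _ _ hl.1
  have h0 : pebCount (initConfig : Config (TNode d m)) Peb.blue = 0 := by
    simp [pebCount, initConfig]
  omega

/-- The configuration in which the group feeding chain node `n` is entirely red, the other group is
red on its first `i` nodes and blue elsewhere, and the red chain nodes are those in `S`. -/
def layout (d i n : ℕ) (S : Finset (Fin m)) : Config (TNode d m)
  | Sum.inl (Sum.inl k) => if n % 2 = 0 ∨ k.val < i then some Peb.red else some Peb.blue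
  | Sum.inl (Sum.inr k) => if n % 2 = 1 ∨ k.val < i then some Peb.red else some Peb.blue
  | Sum.inr k => if k ∈ S then some Peb.red else none

/-- The red nodes of `layout d i n S`. -/
def layoutRed (d i n : ℕ) (S : Finset (Fin m)) : Finset (TNode d m) :=
  ((Finset.univ.filter fun k : Fin d => n % 2 = 0 ∨ k.val < i).disjSum
    (Finset.univ.filter fun k : Fin d => n % 2 = 1 ∨ k.val < i)).disjSum S

theorem mem_layoutRed_of_red {i n : ℕ} {S : Finset (Fin m)} {v : TNode d m}
    (h : layout d i n S v = some Peb.red) : v ∈ layoutRed d i n S := by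
  rcases v with (v | v) | v <;> simp [layout] at h <;> simp [layoutRed] <;> grind

theorem card_layoutRed {i : ℕ} (hi : i ≤ d) (n : ℕ) (S : Finset (Fin m)) :
    (layoutRed d i n S).card = d + i + S.card := by
  have hlow : (Finset.univ.filter fun k : Fin d => k.val < i).card = i := by
    rw [Fin.card_filter_val_lt]
    omega
  rcases Nat.mod_two_eq_zero_or_one n with h | h <;>
    (simp [layoutRed, Finset.card_disjSum, h, hlow]; try omega)

/-- The nodes of the group feeding chain node `n` other than the first `i`. -/
def highCtrl (d m i n : ℕ) : Finset (TNode d m) :=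
  (Finset.univ.filter fun k : Fin d => i ≤ k.val).map ⟨ctrl d m n, ctrl_injective n⟩

theorem card_highCtrl {i : ℕ} (n : ℕ) : (highCtrl d m i n).card = d - i := by
  have h := Finset.card_filter_add_card_filter_not (s := (Finset.univ : Finset (Fin d)))
    (fun k => k.val < i)
  simp only [not_lt, Fin.card_filter_val_lt, Finset.card_univ, Fintype.card_fin] at h
  rw [highCtrl, Finset.card_map]
  omega

@[simp]
theorem inl_inl_mem_highCtrl {i n : ℕ} {k : Fin d} :
    (Sum.inl (Sum.inl k) : TNode d m) ∈ highCtrl d m i n ↔ n % 2 = 0 ∧ i ≤ k.val := by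
  by_cases h : n % 2 = 0 <;> simp [highCtrl, ctrl, h]

@[simp]
theorem inl_inr_mem_highCtrl {i n : ℕ} {k : Fin d} :
    (Sum.inl (Sum.inr k) : TNode d m) ∈ highCtrl d m i n ↔ n % 2 = 1 ∧ i ≤ k.val := by
  rcases Nat.mod_two_eq_zero_or_one n with h | h <;> simp [highCtrl, ctrl, h]

@[simp]
theorem inr_notMem_highCtrl {i n : ℕ} {k : Fin m} :
    (Sum.inr k : TNode d m) ∉ highCtrl d m i n := by
  by_cases h : n % 2 = 0 <;> simp [highCtrl, ctrl, h]

/-- The moves exchanging the group feeding chain node `n` for the other group. -/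
noncomputable def swapMoves (d m i n : ℕ) : List (Move (TNode d m)) :=
  (highCtrl d m i n).toList.map Move.toBlue ++ (highCtrl d m i (n + 1)).toList.map Move.toRed

theorem swapMoves_spec {i R : ℕ} (hi : i ≤ d) (n : ℕ) (S : Finset (Fin m))
    (hR : d + i + S.card ≤ R) :
    ValidFrom (tEdge d m) R (layout d i n S) (swapMoves d m i n) ∧
      runMoves (layout d i n S) (swapMoves d m i n) = layout d i (n + 1) S := by
  obtain ⟨h₁, h₂⟩ := bulk_moves (edge := tEdge d m) (R := R) Move.toBlue (some Peb.blue)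
    applyMove_toBlue (layoutRed d i n S) (by rw [card_layoutRed hi]; exact hR)
    (highCtrl d m i n).toList (Finset.nodup_toList _) (layout d i n S)
    (fun v hv => mem_layoutRed_of_red hv) (by simp) (by
      intro v hv c' _ hc'
      simp only [legalMove, hc']
      rcases v with (v | v) | v <;> simp at hv <;> simp [layout, hv])
  have hmid : ∀ v, runMoves (layout d i n S) ((highCtrl d m i n).toList.map Move.toBlue) v =
      if v ∈ highCtrl d m i n then some Peb.blue else layout d i n S v := by
    intro v
    rw [h₂]
    simp
  generalize hc : runMoves (layout d i n S) ((highCtrl d m i n).toList.map Move.toBlue) = c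
  rw [hc] at hmid
  have hmod : (n + 1) % 2 = 0 ↔ n % 2 = 1 := by omega
  have hmod' : (n + 1) % 2 = 1 ↔ n % 2 = 0 := by omega
  obtain ⟨h₃, h₄⟩ := bulk_moves (edge := tEdge d m) (R := R) Move.toRed (some Peb.red)
    applyMove_toRed (layoutRed d i (n + 1) S) (by rw [card_layoutRed hi]; exact hR)
    (highCtrl d m i (n + 1)).toList (Finset.nodup_toList _) c
    (by
      intro v hv
      rw [hmid] at hv
      rcases v with (v | v) | v <;> simp [layout] at hv <;> simp [layoutRed] <;> grind)
    (by
      rintro - v hv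
      rcases v with (v | v) | v <;> simp at hv <;> simp [layoutRed, hv])
    (by
      intro v hv c' _ hc'
      simp only [legalMove, hc', hmid]
      rcases v with (v | v) | v <;> simp at hv <;> simp [layout, hv])
  refine ⟨?_, ?_⟩
  · rw [swapMoves, validFrom_append, hc]
    exact ⟨h₁, h₃⟩
  · rw [swapMoves, runMoves_append, hc, h₄]
    funext v
    rw [hmid]
    rcases v with (v | v) | v <;> simp [layout] <;> grind

theorem compute_spec {i R n : ℕ} (hi : i ≤ d) (S : Finset (Fin m)) (j : Fin m)
    (hn : n % 2 = j.val % 2) (hpred : ∀ k : Fin m, k.val + 1 = j.val → k ∈ S)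
    (hR : d + i + (S.card + 1) ≤ R) :
    ValidFrom (tEdge d m) R (layout d i n S) [Move.compute (Sum.inr j)] ∧
      runMoves (layout d i n S) [Move.compute (Sum.inr j)] = layout d i n (insert j S) := by
  have hcfg : applyMove (layout d i n S) (Move.compute (Sum.inr j)) =
      layout d i n (insert j S) := by
    rw [applyMove_compute]
    funext v
    by_cases hv : v = Sum.inr j
    · subst hv
      simp [layout]
    · rw [setAt_of_ne _ hv]
      rcases v with (v | v) | v
      · rfl
      · rfl
      · have : v ≠ j := fun h => hv (by rw [h])
        simp [layout, this]
  refine ⟨⟨?_, ?_, trivial⟩, hcfg⟩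
  · rintro ((u | u) | u) hu <;> simp only [tEdge] at hu
    · simp [layout, hn, hu]
    · simp [layout, hn, hu]
    · simp [layout, hpred u hu]
  · rw [hcfg]
    refine (redCount_le_card _ fun v hv => mem_layoutRed_of_red hv).trans ?_
    rw [card_layoutRed hi]
    have := Finset.card_insert_le j S
    omega

theorem delete_spec {i R n : ℕ} (hi : i ≤ d) (S : Finset (Fin m)) (j : Fin m) (hj : j ∈ S)
    (hR : d + i + S.card ≤ R) :
    ValidFrom (tEdge d m) R (layout d i n S) [Move.delete (Sum.inr j)] ∧
      runMoves (layout d i n S) [Move.delete (Sum.inr j)] = layout d i n (S.erase j) := by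
  have hcfg : applyMove (layout d i n S) (Move.delete (Sum.inr j)) =
      layout d i n (S.erase j) := by
    rw [applyMove_delete]
    funext v
    by_cases hv : v = Sum.inr j
    · subst hv
      simp [layout]
    · rw [setAt_of_ne _ hv]
      rcases v with (v | v) | v
      · rfl
      · rfl
      · have : v ≠ j := fun h => hv (by rw [h])
        simp [layout, this]
  refine ⟨⟨?_, ?_, trivial⟩, hcfg⟩
  · simp [legalMove, layout, hj]
  · rw [hcfg]
    refine (redCount_le_card _ fun v hv => mem_layoutRed_of_red hv).trans ?_
    rw [card_layoutRed hi]
    have := Finset.card_erase_le (s := S) (a := j)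
    omega

/-- The moves computing all control nodes. -/
noncomputable def setupMoves (d m i : ℕ) : List (Move (TNode d m)) :=
  (highCtrl d m i 1).toList.map Move.compute ++
    ((highCtrl d m i 1).toList.map Move.toBlue ++
      (layoutRed d i 0 ∅).toList.map Move.compute)

theorem legalMove_compute_inl (c : Config (TNode d m)) (v : Fin d ⊕ Fin d) :
    legalMove (tEdge d m) c (Move.compute (Sum.inl v)) := by
  rintro ((u | u) | u) hu <;> exact hu.elim

theorem setupMoves_spec {i R : ℕ} (hi : i ≤ d) (hR : d + i ≤ R) :
    ValidFrom (tEdge d m) R initConfig (setupMoves d m i) ∧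
      runMoves initConfig (setupMoves d m i) = layout d i 0 ∅ := by
  obtain ⟨h₁, h₂⟩ := bulk_moves (edge := tEdge d m) (R := R) Move.compute (some Peb.red)
    applyMove_compute (highCtrl d m i 1) (by rw [card_highCtrl]; omega)
    (highCtrl d m i 1).toList (Finset.nodup_toList _) initConfig
    (by simp [initConfig]) (by simp) (by
      rintro (v | v) hv c' - -
      · exact legalMove_compute_inl c' v
      · simp at hv)
  have hfst : ∀ v, runMoves initConfig ((highCtrl d m i 1).toList.map Move.compute) v =
      if v ∈ highCtrl d m i 1 then some Peb.red else none := by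
    intro v
    rw [h₂]
    simp [initConfig]
  generalize hc : runMoves initConfig ((highCtrl d m i 1).toList.map Move.compute) = c
  rw [hc] at hfst
  obtain ⟨h₃, h₄⟩ := bulk_moves (edge := tEdge d m) (R := R) Move.toBlue (some Peb.blue)
    applyMove_toBlue (highCtrl d m i 1) (by rw [card_highCtrl]; omega)
    (highCtrl d m i 1).toList (Finset.nodup_toList _) c
    (fun v hv => by simpa [hfst] using hv) (by simp) (by
      intro v hv c' _ hc'
      simp only [legalMove, hc', hfst]
      simpa using hv)
  have hsnd : ∀ v, runMoves c ((highCtrl d m i 1).toList.map Move.toBlue) v =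
      if v ∈ highCtrl d m i 1 then some Peb.blue else none := by
    intro v
    rw [h₄]
    simp only [Finset.mem_toList, hfst]
    split_ifs <;> rfl
  generalize hc' : runMoves c ((highCtrl d m i 1).toList.map Move.toBlue) = c'
  rw [hc'] at hsnd
  obtain ⟨h₅, h₆⟩ := bulk_moves (edge := tEdge d m) (R := R) Move.compute (some Peb.red)
    applyMove_compute (layoutRed d i 0 ∅) (by rw [card_layoutRed hi]; simpa using hR)
    (layoutRed d i 0 ∅).toList (Finset.nodup_toList _) c'
    (fun v hv => by
      rw [hsnd] at hv
      split_ifs at hv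
      simp at hv) (by simp) (by
      rintro (v | v) hv c' - -
      · exact legalMove_compute_inl c' v
      · simp [layoutRed] at hv)
  refine ⟨?_, ?_⟩
  · rw [setupMoves, validFrom_append, validFrom_append, hc, hc']
    exact ⟨h₁, h₃, h₅⟩
  · rw [setupMoves, runMoves_append, runMoves_append, hc, hc', h₆]
    funext v
    rw [hsnd]
    rcases v with (v | v) | v <;> simp [layout, layoutRed] <;> grind

theorem count_compute_map (s : Finset V) [DecidableEq V] (v : V) :
    (s.toList.map Move.compute).count (Move.compute v) = if v ∈ s then 1 else 0 := by
  rw [List.count_map_of_injective _ _ (fun a b h => by simpa using h)]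
  split_ifs with h
  · exact List.count_eq_one_of_mem (Finset.nodup_toList _) (by simpa using h)
  · exact List.count_eq_zero.2 (by simpa using h)

theorem count_compute_singleton [DecidableEq V] (u v : V) :
    [Move.compute u].count (Move.compute v) = if v = u then 1 else 0 := by
  by_cases h : v = u
  · simp [h]
  · simp [h, Ne.symm h]

theorem cost_append (l₁ l₂ : List (Move V)) : cost (l₁ ++ l₂) = cost l₁ + cost l₂ := by
  simp [cost]

theorem cost_map_of_true (f : V → Move V) (hf : ∀ v, isTransfer (f v) = true) (l : List V) :
    cost (l.map f) = l.length := by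
  induction l with
  | nil => rfl
  | cons a l ih => simpa [cost, hf] using ih

theorem cost_map_of_false (f : V → Move V) (hf : ∀ v, isTransfer (f v) = false) (l : List V) :
    cost (l.map f) = 0 := by
  simp [cost, hf]

/-- Swapping the control groups before each chain node computes the chain at a cost of `2 * (d - i)`
per node. -/
theorem exists_moves_layout {i : ℕ} (hi : i ≤ d) (n : ℕ) (hn : n < m) :
    ∃ l : List (Move (TNode d m)), ValidFrom (tEdge d m) (d + 2 + i) initConfig l ∧
      runMoves initConfig l = layout d i n {⟨n, hn⟩} ∧ Oneshot l ∧
      (∀ k : Fin m, n < k.val → l.count (Move.compute (Sum.inr k)) = 0) ∧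
      cost l = (d - i) + 2 * ((d - i) * n) := by
  induction n with
  | zero =>
    obtain ⟨h₁, h₂⟩ := setupMoves_spec (m := m) (R := d + 2 + i) hi (by omega)
    obtain ⟨h₃, h₄⟩ := compute_spec (R := d + 2 + i) (n := 0) hi ∅ ⟨0, hn⟩ rfl (by simp)
      (by simp only [Finset.card_empty]; omega)
    have hcount : ∀ v : TNode d m, (setupMoves d m i ++ [Move.compute (Sum.inr (⟨0, hn⟩ : Fin m))]).count
        (Move.compute v) = (if v ∈ highCtrl d m i 1 then 1 else 0) +
        ((if v ∈ layoutRed d i 0 ∅ then 1 else 0) + if v = Sum.inr ⟨0, hn⟩ then 1 else 0) := by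
      intro v
      have : ((highCtrl d m i 1).toList.map Move.toBlue).count (Move.compute v) = 0 :=
        List.count_eq_zero.2 (by simp)
      simp only [setupMoves, List.count_append, count_compute_map, this,
        count_compute_singleton, zero_add, add_assoc]
    refine ⟨setupMoves d m i ++ [Move.compute (Sum.inr (⟨0, hn⟩ : Fin m))], ?_, ?_, ?_, ?_, ?_⟩
    · rw [validFrom_append, h₂]
      exact ⟨h₁, h₃⟩
    · rw [runMoves_append, h₂, h₄]
      simp
    · intro v
      rw [hcount]
      rcases v with (v | v) | v <;> simp [layoutRed] <;> grind
    · intro k hk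
      rw [hcount]
      have : k ≠ ⟨0, hn⟩ := by
        rintro rfl
        simp at hk
      simp [layoutRed, this]
    · simp only [setupMoves, cost_append]
      rw [cost_map_of_false _ (fun _ => rfl), cost_map_of_true _ (fun _ => rfl),
        cost_map_of_false _ (fun _ => rfl), Finset.length_toList, card_highCtrl]
      simp [cost, isTransfer]
  | succ n ih =>
    obtain ⟨l, h₁, h₂, h₃, h₄, h₅⟩ := ih (by omega)
    have hne : (⟨n + 1, hn⟩ : Fin m) ≠ ⟨n, by omega⟩ := by simp
    obtain ⟨s₁, s₂⟩ := swapMoves_spec (R := d + 2 + i) hi n {(⟨n, by omega⟩ : Fin m)}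
      (by simp only [Finset.card_singleton]; omega)
    obtain ⟨c₁, c₂⟩ := compute_spec (R := d + 2 + i) (n := n + 1) hi {(⟨n, by omega⟩ : Fin m)}
      ⟨n + 1, hn⟩ rfl (fun k hk => by
        simp only at hk
        simp only [Finset.mem_singleton, Fin.ext_iff]
        omega)
      (by simp only [Finset.card_singleton]; omega)
    obtain ⟨e₁, e₂⟩ := delete_spec (R := d + 2 + i) (n := n + 1) hi
      {(⟨n + 1, hn⟩ : Fin m), ⟨n, by omega⟩} ⟨n, by omega⟩ (by simp)
      (by rw [Finset.card_pair hne]; omega)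
    have hcount : ∀ v : TNode d m, (l ++ (swapMoves d m i n ++
        ([Move.compute (Sum.inr (⟨n + 1, hn⟩ : Fin m))] ++ [Move.delete (Sum.inr (⟨n, by omega⟩ : Fin m))]))).count
        (Move.compute v) = l.count (Move.compute v) +
          if v = Sum.inr ⟨n + 1, hn⟩ then 1 else 0 := by
      intro v
      have : (swapMoves d m i n).count (Move.compute v) = 0 :=
        List.count_eq_zero.2 (by simp [swapMoves])
      have hdel : [Move.delete (Sum.inr (⟨n, by omega⟩ : Fin m) : TNode d m)].count
          (Move.compute v) = 0 := List.count_eq_zero.2 (by simp)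
      simp only [List.count_append, this, hdel, count_compute_singleton, zero_add, add_zero]
    refine ⟨l ++ (swapMoves d m i n ++ ([Move.compute (Sum.inr (⟨n + 1, hn⟩ : Fin m))] ++
      [Move.delete (Sum.inr (⟨n, by omega⟩ : Fin m))])), ?_, ?_, ?_, ?_, ?_⟩
    · rw [validFrom_append, validFrom_append, validFrom_append, h₂, s₂, c₂]
      exact ⟨h₁, s₁, c₁, e₁⟩
    · rw [runMoves_append, runMoves_append, runMoves_append, h₂, s₂, c₂, e₂]
      congr 1
      ext k
      simp only [Finset.mem_erase, Finset.mem_insert, Finset.mem_singleton]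
      grind
    · intro v
      rw [hcount]
      split_ifs with hv
      · rw [hv, h₄ _ (by simp)]
      · exact h₃ v
    · intro k hk
      rw [hcount, h₄ k (by omega), if_neg]
      intro h
      have := congrArg Fin.val (Sum.inr_injective h)
      simp only at this
      omega
    · simp only [swapMoves, cost_append]
      rw [cost_map_of_true _ (fun _ => rfl), cost_map_of_true _ (fun _ => rfl),
        Finset.length_toList, Finset.length_toList, card_highCtrl, card_highCtrl, h₅]
      simp [cost, isTransfer]
      ring

theorem exists_pebbling {i : ℕ} (hi : i ≤ d) (hm : 1 ≤ m) :
    ∃ l : List (Move (TNode d m)), IsPebbling (tEdge d m) (d + 2 + i) l ∧ Oneshot l ∧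
      cost l ≤ 2 * ((d - i) * m) := by
  obtain ⟨l, h₁, h₂, h₃, -, h₅⟩ := exists_moves_layout (m := m) hi (m - 1) (by omega)
  refine ⟨l, ⟨h₁, ?_⟩, h₃, ?_⟩
  · intro v hv
    rw [h₂]
    rcases v with (v | v) | v
    · simp only [layout]
      split_ifs <;> simp
    · simp only [layout]
      split_ifs <;> simp
    · have hlast : v = ⟨m - 1, by omega⟩ := by
        by_contra h
        have hval : v.val ≠ m - 1 := fun h' => h (Fin.ext h')
        exact hv (Sum.inr ⟨v.val + 1, by omega⟩) rfl
      simp [layout, hlast]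
  · obtain ⟨k, rfl⟩ : ∃ k, m = k + 1 := ⟨m - 1, by omega⟩
    rw [h₅]
    simp only [Nat.add_sub_cancel, mul_add, mul_one]
    omega

end Tradeoff


/-- For every `d ≥ 1` and `0 ≤ i ≤ d`, the optimal oneshot
pebbling cost of `T(d,m)` with `d + 2 + i` red pebbles equals `2(d − i)·m` up
to an additive error bounded by a constant depending on `d` and `i` alone
(independent of `m`): `opt(d + 2 + i) = 2(d − i)·m + O(1)` as `m → ∞`. -/
theorem tradeoff_opt_interpolation
    (d i : ℕ) (hd : 1 ≤ d) (hi : i ≤ d) :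
    ∃ C : ℕ, ∀ m : ℕ, 1 ≤ m →
      |(optCost (tEdge d m) (d + 2 + i) : ℤ) - 2 * ((d : ℤ) - (i : ℤ)) * (m : ℤ)|
        ≤ (C : ℤ) := by
  refine ⟨8 * d, fun m hm => ?_⟩
  obtain ⟨l, hl, ho, hc⟩ := exists_pebbling (m := m) hi hm
  have hupper : optCost (tEdge d m) (d + 2 + i) ≤ cost l := Nat.sInf_le ⟨l, hl, ho, rfl⟩
  obtain ⟨l', hl', ho', hc'⟩ : optCost (tEdge d m) (d + 2 + i) ∈
      {c | ∃ moves : List (Move (TNode d m)),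
        IsPebbling (tEdge d m) (d + 2 + i) moves ∧ Oneshot moves ∧ cost moves = c} :=
    Nat.sInf_mem ⟨_, l, hl, ho, rfl⟩
  have hlower := le_cost i hm l' hl' ho'
  rw [hc'] at hlower
  have hcast : 2 * ((d : ℤ) - (i : ℤ)) * (m : ℤ) = ((2 * ((d - i) * m) : ℕ) : ℤ) := by
    push_cast [Nat.cast_sub hi]
    ring
  rw [hcast, abs_le]
  constructor <;> push_cast <;> omega

end RBPebble
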